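/- Let M : ℝˡ × ℝⁿ ⇒ ℝᵐ have closed graph and 0 ∈ M(p̄, x̄). Assume there do not exist u ∈ ℝⁿ with ‖u‖ = 1, q* ∈ ℝˡ with ‖q*‖ = 1, and sequences (q_k, u_k, v_k) → (0, u, 0), (q*_k, u*_k, v*_k) → (q*, 0, 0), t_k ↓ 0 such that (q*_k, u*_k) ∈ D̂*M((p̄,x̄,0) + t_k(q_k,u_k,v_k))(v*_k) for all k, q_k ≠ 0 for all k, and ⟨q*_k, q_k/‖q_k‖⟩ → −1. Then M has the restricted calmness property with respect to p at (p̄, x̄, 0). -/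

import Mathlib

open Filter Topology Metric Set
open scoped RealInnerProductSpace

noncomputable section

abbrev Es (k : ℕ) : Type := EuclideanSpace ℝ (Fin k)

/-- The tangent (contingent) cone to `A` at `x`. -/
def tcone {E : Type*} [NormedAddCommGroup E] [NormedSpace ℝ E] (A : Set E) (x : E) : Set E :=
  {w | ∃ t : ℕ → ℝ, ∃ w' : ℕ → E,
    (∀ k, 0 < t k) ∧ Tendsto t atTop (𝓝 0) ∧ Tendsto w' atTop (𝓝 w) ∧
    ∀ k, x + t k • w' k ∈ A}

/-- Graph of a multifunction of two variables, as a subset of a triple product. -/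
def gph3 {P X Y : Type*} (M : P × X → Set Y) : Set (P × X × Y) :=
  {z | z.2.2 ∈ M (z.1, z.2.1)}

/-- The canonical pairing on a triple product of real inner product spaces. -/
def pr3 {P X Y : Type*} [NormedAddCommGroup P] [InnerProductSpace ℝ P]
    [NormedAddCommGroup X] [InnerProductSpace ℝ X]
    [NormedAddCommGroup Y] [InnerProductSpace ℝ Y] (a b : P × X × Y) : ℝ :=
  ⟪a.1, b.1⟫ + ⟪a.2.1, b.2.1⟫ + ⟪a.2.2, b.2.2⟫

/-- The regular (Fréchet) normal cone to `A ⊆ P × X × Y` at `z`; it is empty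
(by convention) when `z ∉ A`. -/
def rnc3 {P X Y : Type*} [NormedAddCommGroup P] [InnerProductSpace ℝ P]
    [NormedAddCommGroup X] [InnerProductSpace ℝ X]
    [NormedAddCommGroup Y] [InnerProductSpace ℝ Y]
    (A : Set (P × X × Y)) (z : P × X × Y) : Set (P × X × Y) :=
  {zs | z ∈ A ∧ ∀ w ∈ tcone A z, pr3 zs w ≤ 0}

/-- The directional limiting normal cone to `A ⊆ P × X × Y` at `z` in direction `w`. -/
def dnc3 {P X Y : Type*} [NormedAddCommGroup P] [InnerProductSpace ℝ P]
    [NormedAddCommGroup X] [InnerProductSpace ℝ X]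
    [NormedAddCommGroup Y] [InnerProductSpace ℝ Y]
    (A : Set (P × X × Y)) (z w : P × X × Y) : Set (P × X × Y) :=
  {zs | ∃ t : ℕ → ℝ, ∃ w' : ℕ → P × X × Y, ∃ zs' : ℕ → P × X × Y,
    (∀ k, 0 < t k) ∧ Tendsto t atTop (𝓝 0) ∧ Tendsto w' atTop (𝓝 w) ∧
    Tendsto zs' atTop (𝓝 zs) ∧ ∀ k, zs' k ∈ rnc3 A (z + t k • w' k)}

/-- The ℓ² distance on the product of two metric spaces. -/
def dist2 {X Y : Type*} [MetricSpace X] [MetricSpace Y] (a b : X × Y) : ℝ :=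
  Real.sqrt (dist a.1 b.1 ^ 2 + dist a.2 b.2 ^ 2)

/-- Distance from a point to a set with respect to the ℓ² product metric. -/
def infDist2 {X Y : Type*} [MetricSpace X] [MetricSpace Y] (a : X × Y) (B : Set (X × Y)) : ℝ :=
  sInf (dist2 a '' B)

/-- `M : P × X ⇒ Y` has the restricted calmness property with respect to `p` at
`(pb, xb, yb)`, the distance in `X × Y` being the ℓ² product metric. -/
def RestrCalm {P X Y : Type*} [MetricSpace P] [MetricSpace X] [MetricSpace Y]
    (M : P × X → Set Y) (pb : P) (xb : X) (yb : Y) : Prop :=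
  ∃ L : ℝ, 0 ≤ L ∧ ∃ ε : ℝ, 0 < ε ∧ ∀ p x, dist p pb < ε → dist x xb < ε → yb ∈ M (p, x) →
    infDist2 (x, yb) {z : X × Y | z.2 ∈ M (pb, z.1)} ≤ L * dist p pb

theorem tcone_subset_posTangentConeAt {E : Type*} [NormedAddCommGroup E] [NormedSpace ℝ E]
    (A : Set E) (x : E) : tcone A x ⊆ posTangentConeAt A x := by
  rintro w ⟨t, w', htpos, ht, hw, hA⟩
  refine mem_tangentConeAt_of_seq atTop (fun k => (t k)⁻¹.toNNReal) (fun k => t k • w' k)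
    (by simpa using ht.smul hw) (Eventually.of_forall hA) (hw.congr fun k => ?_)
  rw [NNReal.smul_def, Real.coe_toNNReal _ (inv_nonneg.2 (htpos k).le),
    inv_smul_smul₀ (htpos k).ne']

theorem infDist2_le {X Y : Type*} [MetricSpace X] [MetricSpace Y]
    {a b : X × Y} {B : Set (X × Y)} (hb : b ∈ B) : infDist2 a B ≤ dist2 a b :=
  csInf_le ⟨0, by rintro _ ⟨c, -, rfl⟩; exact Real.sqrt_nonneg _⟩ (mem_image_of_mem _ hb)

/-- A penalty function measuring the deviation from `pb` and from `(x₀, 0)`; it is smooth away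
from `pb`. -/
def penalty {P X Y : Type*} [NormedAddCommGroup P] [NormedAddCommGroup X]
    [NormedAddCommGroup Y] (pb : P) (x₀ : X) (d : ℝ) (z : P × X × Y) : ℝ :=
  ‖z.1 - pb‖ + d⁻¹ * (‖z.2.1 - x₀‖ ^ 2 + ‖z.2.2‖ ^ 2)

theorem continuous_penalty {P X Y : Type*} [NormedAddCommGroup P] [NormedAddCommGroup X]
    [NormedAddCommGroup Y] (pb : P) (x₀ : X) (d : ℝ) :
    Continuous (penalty pb x₀ d : P × X × Y → ℝ) := by
  unfold penalty
  fun_prop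

/-- Every sublevel set of the penalty function is bounded, so a minimiser exists on a closed set. -/
theorem exists_isMinOn_penalty {P X Y : Type*} [NormedAddCommGroup P] [NormedAddCommGroup X]
    [NormedAddCommGroup Y] [ProperSpace P] [ProperSpace X] [ProperSpace Y]
    {A : Set (P × X × Y)} (hA : IsClosed A) {pb p : P} {x : X} {d : ℝ} (hd : 0 < d)
    (hmem : (p, x, (0 : Y)) ∈ A) (hp : ‖p - pb‖ < d) :
    ∃ z ∈ A, IsMinOn (penalty pb x d) A z := by
  refine (continuous_penalty pb x d).continuousOn.exists_isMinOn' hA hmem ?_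
  have hK : IsCompact (closedBall pb d ×ˢ closedBall x d ×ˢ closedBall (0 : Y) d) :=
    (isCompact_closedBall _ _).prod ((isCompact_closedBall _ _).prod (isCompact_closedBall _ _))
  filter_upwards [mem_inf_of_left hK.compl_mem_cocompact] with z hz
  have h0 : penalty pb x d (p, x, (0 : Y)) = ‖p - pb‖ := by simp [penalty]
  rw [h0]
  refine hp.le.trans ?_
  by_contra! hlt
  apply hz
  have hsq : ‖z.2.1 - x‖ ^ 2 + ‖z.2.2‖ ^ 2 < d * d := by
    rw [← inv_mul_lt_iff₀ hd]
    exact lt_of_le_of_lt (le_add_of_nonneg_left (norm_nonneg _)) hlt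
  have hpos : 0 ≤ d⁻¹ * (‖z.2.1 - x‖ ^ 2 + ‖z.2.2‖ ^ 2) := by positivity
  refine ⟨?_, ?_, ?_⟩
  · rw [mem_closedBall, dist_eq_norm]
    unfold penalty at hlt
    linarith
  · rw [mem_closedBall, dist_eq_norm]
    nlinarith [norm_nonneg (z.2.1 - x), sq_nonneg ‖z.2.2‖]
  · rw [mem_closedBall, dist_eq_norm, sub_zero]
    nlinarith [norm_nonneg z.2.2, sq_nonneg ‖z.2.1 - x‖]

section Penalization

variable {P X Y : Type*} [NormedAddCommGroup P] [InnerProductSpace ℝ P]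
  [NormedAddCommGroup X] [InnerProductSpace ℝ X]
  [NormedAddCommGroup Y] [InnerProductSpace ℝ Y]

theorem mem_rnc3_of_isMinOn {A : Set (P × X × Y)} {z zs : P × X × Y} {f : P × X × Y → ℝ}
    {f' : P × X × Y →L[ℝ] ℝ} (hz : z ∈ A) (hmin : IsMinOn f A z) (hf : HasFDerivAt f f' z)
    (hzs : ∀ w, f' w = -pr3 zs w) : zs ∈ rnc3 A z := by
  refine ⟨hz, fun w hw => ?_⟩
  have h := hmin.localize.hasFDerivWithinAt_nonneg hf.hasFDerivWithinAt
    (tcone_subset_posTangentConeAt A z hw)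
  rw [hzs] at h
  linarith

theorem hasFDerivAt_norm_of_ne_zero {x : P} (hx : x ≠ 0) :
    HasFDerivAt (fun y : P => ‖y‖) (‖x‖⁻¹ • innerSL ℝ x) x := by
  have hx' : ‖x‖ ≠ 0 := norm_ne_zero_iff.2 hx
  have h := (hasStrictFDerivAt_norm_sq x).hasFDerivAt.sqrt (pow_ne_zero 2 hx')
  simp only [Real.sqrt_sq (norm_nonneg _)] at h
  convert h using 1
  ext w
  simp
  field_simp

theorem neg_gradient_penalty_mem_rnc3 {A : Set (P × X × Y)} {pb : P} {x₀ : X} {d : ℝ}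
    {z : P × X × Y} (hz : z ∈ A) (hmin : IsMinOn (penalty pb x₀ d) A z) (hne : z.1 ≠ pb) :
    (-(‖z.1 - pb‖⁻¹ • (z.1 - pb)), -((2 / d) • (z.2.1 - x₀)), -((2 / d) • z.2.2)) ∈
      rnc3 A z := by
  have h1 : HasFDerivAt (fun z : P × X × Y => z.1 - pb) (ContinuousLinearMap.fst ℝ P (X × Y)) z :=
    hasFDerivAt_fst.sub_const pb
  have hs : HasFDerivAt (fun z : P × X × Y => z.2) (ContinuousLinearMap.snd ℝ P (X × Y)) z :=
    hasFDerivAt_snd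
  have h2 := (hs.fst.sub_const x₀).norm_sq
  have h3 := hs.snd.norm_sq
  have h1' := (hasFDerivAt_norm_of_ne_zero (sub_ne_zero.2 hne)).comp z h1
  refine mem_rnc3_of_isMinOn hz hmin (h1'.add ((h2.add h3).const_mul d⁻¹)) fun w => ?_
  simp [pr3, inner_smul_left, inner_sub_left]
  ring

theorem exists_neg_gradient_mem_rnc3 [ProperSpace P] [ProperSpace X] [ProperSpace Y]
    {A : Set (P × X × Y)} (hA : IsClosed A) {pb p : P} {x : X} {d N : ℝ} (hN : 1 ≤ N)
    (hmem : (p, x, (0 : Y)) ∈ A) (hp : N ^ 2 * ‖p - pb‖ < d)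
    (hdist : ∀ x' y', (pb, x', y') ∈ A → d ^ 2 ≤ ‖x' - x‖ ^ 2 + ‖y'‖ ^ 2) :
    ∃ p' x' y', p' ≠ pb ∧ N ^ 2 * ‖p' - pb‖ < d ∧ N * ‖x' - x‖ < d ∧ N * ‖y'‖ < d ∧
      (-(‖p' - pb‖⁻¹ • (p' - pb)), -((2 / d) • (x' - x)), -((2 / d) • y')) ∈
        rnc3 A (p', x', y') := by
  have hd : 0 < d := lt_of_le_of_lt (by positivity) hp
  have hN2 : 1 ≤ N ^ 2 := one_le_pow₀ hN
  have hpd : ‖p - pb‖ < d := by nlinarith [norm_nonneg (p - pb)]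
  obtain ⟨⟨p', x', y'⟩, hz, hmin⟩ := exists_isMinOn_penalty hA hd hmem hpd
  have hle : penalty pb x d (p', x', y') ≤ ‖p - pb‖ := by
    simpa [penalty] using hmin hmem
  have hle' : N ^ 2 * ‖p' - pb‖ + d⁻¹ * (N ^ 2 * (‖x' - x‖ ^ 2 + ‖y'‖ ^ 2)) < d := by
    have := mul_le_mul_of_nonneg_left hle (by positivity : 0 ≤ N ^ 2)
    simp only [penalty] at this
    linarith
  have hp' : N ^ 2 * ‖p' - pb‖ < d := by
    have : 0 ≤ d⁻¹ * (N ^ 2 * (‖x' - x‖ ^ 2 + ‖y'‖ ^ 2)) := by positivity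
    linarith
  have hsq : N ^ 2 * (‖x' - x‖ ^ 2 + ‖y'‖ ^ 2) < d ^ 2 := by
    rw [sq d, ← inv_mul_lt_iff₀ hd]
    have : 0 ≤ N ^ 2 * ‖p' - pb‖ := by positivity
    linarith
  have hne : p' ≠ pb := by
    rintro rfl
    nlinarith [hdist x' y' hz, sq_nonneg ‖x' - x‖, sq_nonneg ‖y'‖]
  refine ⟨p', x', y', hne, hp', ?_, ?_, neg_gradient_penalty_mem_rnc3 hz hmin hne⟩
  · refine lt_of_pow_lt_pow_left₀ 2 hd.le ?_
    nlinarith [mul_nonneg (sq_nonneg N) (sq_nonneg ‖y'‖)]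
  · refine lt_of_pow_lt_pow_left₀ 2 hd.le ?_
    nlinarith [mul_nonneg (sq_nonneg N) (sq_nonneg ‖x' - x‖)]

/-- When restricted calmness fails with modulus `N ^ 2`, the graph has a regular normal of the
critical form at a point whose position relative to the base point is controlled by `N`. -/
theorem exists_critical_normal [ProperSpace P] [ProperSpace X] [ProperSpace Y]
    {M : P × X → Set Y} {pb : P} {xb : X} (hcl : IsClosed (gph3 M)) (hbar : (0 : Y) ∈ M (pb, xb))
    (hM : ¬ RestrCalm M pb xb 0) {N : ℝ} (hN : 2 ≤ N) :
    ∃ (t : ℝ) (q : P) (u : X) (v : Y) (qs : P) (us : X) (vs : Y),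
      0 < t ∧ t ≤ 2 / N ∧ ‖q‖ ≤ 2 / N ∧ ‖u‖ = 1 ∧ ‖v‖ ≤ 2 / N ∧ ‖qs‖ = 1 ∧ ‖us‖ ≤ 2 / N ∧
      ‖vs‖ ≤ 2 / N ∧ (qs, us, -vs) ∈ rnc3 (gph3 M) ((pb, xb, (0 : Y)) + t • (q, u, v)) ∧
      q ≠ 0 ∧ ⟪qs, ‖q‖⁻¹ • q⟫ = -1 := by
  have hN0 : 0 < N := by linarith
  simp only [RestrCalm, not_exists, not_and, not_forall, not_le] at hM
  obtain ⟨p, x, -, hx, h0, hlt⟩ := hM (N ^ 2) (by positivity) N⁻¹ (by positivity)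
  set d := infDist2 (x, (0 : Y)) {z : X × Y | z.2 ∈ M (pb, z.1)} with hd_def
  rw [dist_eq_norm] at hx hlt
  have hd : 0 < d := lt_of_le_of_lt (by positivity) hlt
  have hdx : d ≤ ‖x - xb‖ := by
    have := infDist2_le (a := (x, (0 : Y))) (B := {z : X × Y | z.2 ∈ M (pb, z.1)})
      (b := (xb, 0)) hbar
    simpa [dist2, dist_eq_norm] using this
  obtain ⟨p', x', y', hne, hp', hx', hy', hnor⟩ :=
    exists_neg_gradient_mem_rnc3 hcl (by linarith) h0 hlt fun x' y' h => by
      have := infDist2_le (a := (x, (0 : Y))) (B := {z : X × Y | z.2 ∈ M (pb, z.1)})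
        (b := (x', y')) h
      have h2 := pow_le_pow_left₀ hd.le this 2
      rw [dist2, Real.sq_sqrt (by positivity), dist_comm x, dist_comm (0 : Y)] at h2
      simpa [dist_eq_norm] using h2
  have htri1 : ‖x - xb‖ ≤ ‖x' - x‖ + ‖x' - xb‖ := by
    simpa [dist_eq_norm, norm_sub_rev] using dist_triangle x x' xb
  have htri2 : ‖x' - xb‖ ≤ ‖x' - x‖ + ‖x - xb‖ := by
    simpa [dist_eq_norm] using dist_triangle x' x xb
  have hxd : 2 * ‖x' - x‖ < d := by nlinarith [norm_nonneg (x' - x)]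
  set t := ‖x' - xb‖ with ht_def
  have htd : d < 2 * t := by linarith
  have ht : 0 < t := by linarith
  have hpn : 0 < ‖p' - pb‖ := norm_pos_iff.2 (sub_ne_zero.2 hne)
  have hscale : ∀ {r : ℝ}, N * r < d → t⁻¹ * r ≤ 2 / N := fun {r} h => by
    rw [inv_mul_le_iff₀ ht, mul_div_assoc', le_div_iff₀ hN0]
    linarith
  have hscale' : ∀ {r : ℝ}, N * r < d → 2 / d * r ≤ 2 / N := fun {r} h => by
    rw [div_mul_eq_mul_div, div_le_div_iff₀ hd hN0]
    linarith
  have hqn : ‖t⁻¹ • (p' - pb)‖ = t⁻¹ * ‖p' - pb‖ := by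
    rw [norm_smul, Real.norm_of_nonneg (by positivity)]
  refine ⟨t, t⁻¹ • (p' - pb), t⁻¹ • (x' - xb), t⁻¹ • y', -(‖p' - pb‖⁻¹ • (p' - pb)),
    -((2 / d) • (x' - x)), (2 / d) • y', ht, ?_, ?_, ?_, ?_, ?_, ?_, ?_, ?_, ?_, ?_⟩
  · have : N⁻¹ * 2 = 2 / N := by field_simp
    linarith
  · rw [hqn]
    exact hscale (by nlinarith)
  · rw [norm_smul, Real.norm_of_nonneg (by positivity), ← ht_def, inv_mul_cancel₀ ht.ne']
  · rw [norm_smul, Real.norm_of_nonneg (by positivity)]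
    exact hscale hy'
  · rw [norm_neg, norm_smul, Real.norm_of_nonneg (by positivity), inv_mul_cancel₀ hpn.ne']
  · rw [norm_neg, norm_smul, Real.norm_of_nonneg (by positivity)]
    exact hscale' hx'
  · rw [norm_smul, Real.norm_of_nonneg (by positivity)]
    exact hscale' hy'
  · convert hnor using 1
    simp [smul_inv_smul₀ ht.ne']
  · exact smul_ne_zero (inv_ne_zero ht.ne') (sub_ne_zero.2 hne)
  · rw [hqn, inner_neg_left, inner_smul_left, inner_smul_right, inner_smul_right,
      real_inner_self_eq_norm_sq]
    simp
    field_simp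

end Penalization

/-- Sufficient condition, in terms of regular coderivatives along suitable sequences, for
the restricted calmness property with respect to `p` (Theorem `ThRPCP`). -/
theorem stmt3 {l n m : ℕ}
    (M : Es l × Es n → Set (Es m)) (pb : Es l) (xb : Es n)
    (hcl : IsClosed (gph3 M)) (hbar : (0 : Es m) ∈ M (pb, xb))
    (hyp : ¬ ∃ (u : Es n) (qs : Es l), ‖u‖ = 1 ∧ ‖qs‖ = 1 ∧
      ∃ (t : ℕ → ℝ) (q : ℕ → Es l) (uk : ℕ → Es n) (v : ℕ → Es m)
        (qsk : ℕ → Es l) (usk : ℕ → Es n) (vsk : ℕ → Es m),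
        (∀ k, 0 < t k) ∧ Tendsto t atTop (𝓝 0) ∧
        Tendsto q atTop (𝓝 0) ∧ Tendsto uk atTop (𝓝 u) ∧ Tendsto v atTop (𝓝 0) ∧
        Tendsto qsk atTop (𝓝 qs) ∧ Tendsto usk atTop (𝓝 0) ∧ Tendsto vsk atTop (𝓝 0) ∧
        (∀ k, (qsk k, usk k, -vsk k) ∈
          rnc3 (gph3 M) ((pb, xb, (0 : Es m)) + t k • (q k, uk k, v k))) ∧
        (∀ k, q k ≠ 0) ∧
        Tendsto (fun k => ⟪qsk k, (‖q k‖)⁻¹ • q k⟫) atTop (𝓝 (-1))) :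
    RestrCalm M pb xb 0 := by
  by_contra hM
  have hN : ∀ k : ℕ, (2 : ℝ) ≤ (k : ℝ) + 2 := fun k => by
    have := k.cast_nonneg (α := ℝ)
    linarith
  choose t q u v qs us vs ht htN hq hu hv hqs hus hvs hnor hq0 hinner using
    fun k => exists_critical_normal hcl hbar hM (hN k)
  have hlim : Tendsto (fun k : ℕ => 2 / ((k : ℝ) + 2)) atTop (𝓝 0) :=
    tendsto_const_nhds.div_atTop
      (tendsto_atTop_add_const_right _ _ tendsto_natCast_atTop_atTop)
  obtain ⟨⟨ul, ql⟩, ⟨hul, hql⟩, φ, hφ, hconv⟩ :=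
    ((isCompact_sphere (0 : Es n) 1).prod (isCompact_sphere (0 : Es l) 1)).tendsto_subseq
      (x := fun k => (u k, qs k)) fun k => by simp [hu, hqs]
  have hφ' := hφ.tendsto_atTop
  rw [nhds_prod_eq, tendsto_prod_iff'] at hconv
  refine hyp ⟨ul, ql, by simpa using hul, by simpa using hql, t ∘ φ, q ∘ φ, u ∘ φ, v ∘ φ,
    qs ∘ φ, us ∘ φ, vs ∘ φ, fun k => ht _, (squeeze_zero (fun k => (ht k).le) htN hlim).comp hφ',
    (squeeze_zero_norm hq hlim).comp hφ', hconv.1, (squeeze_zero_norm hv hlim).comp hφ',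
    hconv.2, (squeeze_zero_norm hus hlim).comp hφ', (squeeze_zero_norm hvs hlim).comp hφ',
    fun k => hnor _, fun k => hq0 _, ?_⟩
  simp only [Function.comp_apply, hinner]
  exact tendsto_const_nhds
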